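/- Let H be a Hopf algebra with invertible antipode and B a braided-commutative right-right H-crossed module algebra. Then the action bialgebroid B # H^op is both a left Hopf algebroid and an anti-left Hopf algebroid; explicitly, λ⁻¹((a#h) ⊗_B 1) = (a # h₍₁₎) ⊗_{B^op} (1 # S⁻¹(h₍₂₎)) and μ⁻¹(1 ⊗_B (a#h)) = (1 # a₍₁₎ S(h₍₁₎)) ⊗^{B^op} (a₍₀₎ # h₍₂₎). -/

import Mathlib

open scoped TensorProduct
open TensorProduct

noncomputable section
attribute [local instance] Classical.propDecidable

/-- Choice-based lift of a (bilinear) function to the tensor product: if a linear map agreeing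
with `f` on pure tensors exists, this is it (it is then unique); otherwise `0`. -/
def tlift (R : Type*) [CommRing R] {M N Q : Type*} [AddCommGroup M] [Module R M]
    [AddCommGroup N] [Module R N] [AddCommGroup Q] [Module R Q]
    (f : M → N → Q) : M ⊗[R] N →ₗ[R] Q :=
  if h : ∃ F : M ⊗[R] N →ₗ[R] Q, ∀ x y, F (x ⊗ₜ[R] y) = f x y then h.choose else 0

/-- Choice-based lift of a (bilinear, balanced) function to a quotient of the tensor product. -/
def qtlift (R : Type*) [CommRing R] {M N Q : Type*} [AddCommGroup M] [Module R M]
    [AddCommGroup N] [Module R N] [AddCommGroup Q] [Module R Q]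
    (p : Submodule R (M ⊗[R] N)) (f : M → N → Q) : ((M ⊗[R] N) ⧸ p) →ₗ[R] Q :=
  if h : ∃ F : ((M ⊗[R] N) ⧸ p) →ₗ[R] Q,
      ∀ x y, F (Submodule.Quotient.mk (x ⊗ₜ[R] y)) = f x y then h.choose else 0

variable (k : Type*) [Field k]

/-- Source and target data for a left bialgebroid over `B`: an algebra map `s : B → L` and an
anti-algebra map `t : B → L` with commuting ranges. -/
structure BgdST (B L : Type*) [Ring B] [Algebra k B] [Ring L] [Algebra k L] where
  s : B →ₐ[k] L
  t : B →ₗ[k] L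
  t_one : t 1 = 1
  t_mul : ∀ a b : B, t (a * b) = t b * t a
  st_comm : ∀ a b : B, s a * t b = t b * s a

namespace BgdST

variable {k} {B L : Type*} [Ring B] [Algebra k B] [Ring L] [Algebra k L]
variable (st : BgdST k B L)

/-- The relations defining `L ⊗_B L`: `t a · X ⊗ Y  ~  X ⊗ s a · Y`. -/
def rel : Submodule k (L ⊗[k] L) :=
  Submodule.span k {z | ∃ (a : B) (X Y : L), z = (st.t a * X) ⊗ₜ[k] Y - X ⊗ₜ[k] (st.s a * Y)}

/-- `L ⊗_B L` (the coring tensor square). -/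
abbrev T2 := (L ⊗[k] L) ⧸ st.rel

/-- Class of a pure tensor in `L ⊗_B L`. -/
def mk2 (X Y : L) : st.T2 := Submodule.Quotient.mk (X ⊗ₜ[k] Y)

/-- Evaluate a balanced bilinear expression on an element of `L ⊗_B L`. -/
def lift2 {Q : Type*} [AddCommGroup Q] [Module k Q] (f : L → L → Q) : st.T2 →ₗ[k] Q :=
  qtlift k st.rel f

/-- The relations defining `L ⊗_{B^{op}} L`: `X·t a ⊗ Y ~ X ⊗ t a · Y`. -/
def relOp : Submodule k (L ⊗[k] L) :=
  Submodule.span k {z | ∃ (a : B) (X Y : L), z = (X * st.t a) ⊗ₜ[k] Y - X ⊗ₜ[k] (st.t a * Y)}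

/-- `L ⊗_{B^{op}} L` (domain of the canonical map `λ`). -/
abbrev TOp := (L ⊗[k] L) ⧸ st.relOp

def mkOp (X Y : L) : st.TOp := Submodule.Quotient.mk (X ⊗ₜ[k] Y)

def liftOp {Q : Type*} [AddCommGroup Q] [Module k Q] (f : L → L → Q) : st.TOp →ₗ[k] Q :=
  qtlift k st.relOp f

/-- The relations defining `L ⊗^{B^{op}} L`: `s a · X ⊗ Y ~ X ⊗ Y · s a`. -/
def relA : Submodule k (L ⊗[k] L) :=
  Submodule.span k {z | ∃ (a : B) (X Y : L), z = (st.s a * X) ⊗ₜ[k] Y - X ⊗ₜ[k] (Y * st.s a)}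

/-- `L ⊗^{B^{op}} L` (domain of the canonical map `μ`). -/
abbrev TA := (L ⊗[k] L) ⧸ st.relA

def mkA (X Y : L) : st.TA := Submodule.Quotient.mk (X ⊗ₜ[k] Y)

def liftA {Q : Type*} [AddCommGroup Q] [Module k Q] (f : L → L → Q) : st.TA →ₗ[k] Q :=
  qtlift k st.relA f

/-- Relations for the triple tensor `L ⊗_B L ⊗_B L`. -/
def rel3 : Submodule k (L ⊗[k] (L ⊗[k] L)) :=
  Submodule.span k
    ({z | ∃ (a : B) (X Y Z : L),
        z = (st.t a * X) ⊗ₜ[k] (Y ⊗ₜ[k] Z) - X ⊗ₜ[k] ((st.s a * Y) ⊗ₜ[k] Z)} ∪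
     {z | ∃ (a : B) (X Y Z : L),
        z = X ⊗ₜ[k] ((st.t a * Y) ⊗ₜ[k] Z) - X ⊗ₜ[k] (Y ⊗ₜ[k] (st.s a * Z))})

/-- `L ⊗_B L ⊗_B L`. -/
abbrev T3 := (L ⊗[k] (L ⊗[k] L)) ⧸ st.rel3

def mk3 (X Y Z : L) : st.T3 := Submodule.Quotient.mk (X ⊗ₜ[k] (Y ⊗ₜ[k] Z))

/-- The factorwise product of two elements of `L ⊗_B L`, whenever it is well defined
on representatives (as it is when the left factor lies in the Takeuchi product);
junk value `0` otherwise. -/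
def mulT2 (z w : st.T2) : st.T2 :=
  if h : ∃ u : st.T2, ∀ zr wr : L ⊗[k] L, Submodule.Quotient.mk zr = z →
      Submodule.Quotient.mk wr = w → Submodule.Quotient.mk (zr * wr) = u
  then h.choose else 0

variable (cop : L →ₗ[k] st.T2) (cou : L →ₗ[k] B)

/-- The axioms of a left bialgebroid over `B` with structure `(s,t,Δ,ε) = (st.s, st.t, cop, cou)`
(Definition 2.3 of the paper): `L` is a `B^e`-ring and a `B`-coring, the coproduct corestricts
to an algebra map into the Takeuchi product, and the counit is a left character. -/
structure IsLeftBialgebroid : Prop where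
  comul_one : cop 1 = st.mk2 1 1
  comul_mul : ∀ X Y : L, cop (X * Y) = st.mulT2 (cop X) (cop Y)
  comul_s : ∀ (b : B) (X : L),
    cop (st.s b * X) = st.lift2 (fun x y => st.mk2 (st.s b * x) y) (cop X)
  comul_t : ∀ (b : B) (X : L),
    cop (st.t b * X) = st.lift2 (fun x y => st.mk2 x (st.t b * y)) (cop X)
  takeuchi : ∀ (b : B) (X : L),
    st.lift2 (fun x y => st.mk2 (x * st.t b) y) (cop X) =
      st.lift2 (fun x y => st.mk2 x (y * st.s b)) (cop X)
  coassoc : ∀ X : L,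
    st.lift2 (fun x1 x2 => st.lift2 (fun y1 y2 => st.mk3 x1 y1 y2) (cop x2)) (cop X) =
      st.lift2 (fun x12 x3 => st.lift2 (fun x1 x2 => st.mk3 x1 x2 x3) (cop x12)) (cop X)
  counit_comul_left : ∀ X : L, st.lift2 (fun x1 x2 => st.s (cou x1) * x2) (cop X) = X
  counit_comul_right : ∀ X : L, st.lift2 (fun x1 x2 => st.t (cou x2) * x1) (cop X) = X
  counit_one : cou 1 = 1
  counit_s : ∀ (b : B) (X : L), cou (st.s b * X) = b * cou X
  counit_t : ∀ (b : B) (X : L), cou (st.t b * X) = cou X * b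
  counit_char_s : ∀ X Y : L, cou (X * st.s (cou Y)) = cou (X * Y)
  counit_char_t : ∀ X Y : L, cou (X * st.t (cou Y)) = cou (X * Y)

/-- The canonical map `λ : L ⊗_{B^{op}} L → L ⊗_B L`, `X ⊗ Y ↦ X₍₁₎ ⊗ X₍₂₎Y`. -/
def lam : st.TOp →ₗ[k] st.T2 :=
  st.liftOp (fun X Y => st.lift2 (fun x1 x2 => st.mk2 x1 (x2 * Y)) (cop X))

/-- A left bialgebroid is a left Hopf algebroid if `λ` is bijective. -/
def IsLeftHopf : Prop := Function.Bijective (st.lam cop)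

/-- The canonical map `μ : L ⊗^{B^{op}} L → L ⊗_B L`, `X ⊗ Y ↦ Y₍₁₎X ⊗ Y₍₂₎`. -/
def mu : st.TA →ₗ[k] st.T2 :=
  st.liftA (fun X Y => st.lift2 (fun y1 y2 => st.mk2 (y1 * X) y2) (cop Y))

/-- A left bialgebroid is an anti-left Hopf algebroid if `μ` is bijective. -/
def IsAntiLeftHopf : Prop := Function.Bijective (st.mu cop)

/-- `X₊ ⊗_{B^{op}} X₋ := λ⁻¹(X ⊗_B 1)` (meaningful when `λ` is bijective). -/
def plusMinus (X : L) : st.TOp := Function.invFun (st.lam cop) (st.mk2 X 1)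

/-- `X₍₋₎ ⊗^{B^{op}} X₍₊₎ := μ⁻¹(1 ⊗_B X)` (meaningful when `μ` is bijective). -/
def minusPlus (X : L) : st.TA := Function.invFun (st.mu cop) (st.mk2 1 X)

/-- A left bisection of a left bialgebroid (Definition 3.1). -/
structure IsLeftBisection (σ : L →ₗ[k] B) : Prop where
  unital : σ 1 = 1
  t_prop : ∀ (b : B) (X : L), σ (st.t b * X) = σ X * b
  s_mul : ∀ a b : B, σ (st.s (a * b)) = σ (st.s a) * σ (st.s b)
  s_bij : Function.Bijective (fun b => σ (st.s b))
  prod_t : ∀ X Y : L, σ (X * Y) = σ (X * st.t (σ Y))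
  prod_s : ∀ X Y : L,
    σ (X * Y) = σ (X * st.s (Function.invFun (fun b => σ (st.s b)) (σ Y)))

/-- Convolution of left bisections:  `(σ * η)(X) := σ(s(η(X₍₁₎)) X₍₂₎)`. -/
def bconv (σ η : L →ₗ[k] B) : L →ₗ[k] B :=
  (st.lift2 (fun x1 x2 => σ (st.s (η x1) * x2))).comp cop

/-- A right bisection of a left bialgebroid (Definition 3.6). -/
structure IsRightBisection (σ : L →ₗ[k] B) : Prop where
  unital : σ 1 = 1
  s_prop : ∀ (b : B) (X : L), σ (st.s b * X) = b * σ X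
  t_mul : ∀ a b : B, σ (st.t (a * b)) = σ (st.t b) * σ (st.t a)
  t_bij : Function.Bijective (fun b => σ (st.t b))
  prod_s : ∀ X Y : L, σ (X * Y) = σ (X * st.s (σ Y))
  prod_t : ∀ X Y : L,
    σ (X * Y) = σ (X * st.t (Function.invFun (fun b => σ (st.t b)) (σ Y)))

/-- Convolution of right bisections:  `(σ • η)(X) := σ(t(η(X₍₂₎)) X₍₁₎)`. -/
def rconv (σ η : L →ₗ[k] B) : L →ₗ[k] B :=
  (st.lift2 (fun x1 x2 => σ (st.t (η x2) * x1))).comp cop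

/-- An automorphism `(Φ, φ)` of a left bialgebroid. -/
structure IsBgdAut (Φ : L →ₐ[k] L) (φ : B →ₐ[k] B) : Prop where
  bijL : Function.Bijective Φ
  bijB : Function.Bijective φ
  comp_s : ∀ b : B, Φ (st.s b) = st.s (φ b)
  comp_t : ∀ b : B, Φ (st.t b) = st.t (φ b)
  comp_comul : ∀ X : L,
    cop (Φ X) = st.lift2 (fun x1 x2 => st.mk2 (Φ x1) (Φ x2)) (cop X)
  comp_counit : ∀ X : L, cou (Φ X) = φ (cou X)

/-- `Ad^L_σ(X) := s(σ(X₍₁₎)) X₍₂₎₊ t(σ(X₍₂₎₋))`, for a left Hopf algebroid. -/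
def adL (σ : L →ₗ[k] B) (X : L) : L :=
  st.lift2 (fun x1 x2 => st.s (σ x1) *
    st.liftOp (fun p m => p * st.t (σ m)) (st.plusMinus cop x2)) (cop X)

/-- `Ad^R_σ(X) := t(σ(X₍₂₎)) X₍₁₎₍₊₎ s(σ(X₍₁₎₍₋₎))`, for an anti-left Hopf algebroid. -/
def adR (σ : L →ₗ[k] B) (X : L) : L :=
  st.lift2 (fun x1 x2 => st.t (σ x2) *
    st.liftA (fun m p => p * st.s (σ m)) (st.minusPlus cop x1)) (cop X)

/-- The `B`-bimodule-map conditions on a map `L → B` used for `C¹(L,B)`. -/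
def IsBimodMap (U : L →ₗ[k] B) : Prop :=
  (∀ (b : B) (X : L), U (st.t b * X) = U X * b) ∧
  (∀ (b : B) (X : L), U (st.s b * X) = b * U X)

/-- Convolution `(U * V)(X) = U(X₍₁₎) V(X₍₂₎)` of `B`-valued maps. -/
def cconv (U V : L →ₗ[k] B) : L →ₗ[k] B :=
  (st.lift2 (fun x1 x2 => U x1 * V x2)).comp cop

/-- Extended vertical bisections `C¹(L,B)`: unital convolution-invertible `B`-bimodule maps
`U : L → B` with `U(X s(b)) = U(X t(b))`. -/
def IsC1 (U : L →ₗ[k] B) : Prop :=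
  U 1 = 1 ∧ st.IsBimodMap U ∧
  (∀ (b : B) (X : L), U (X * st.s b) = U (X * st.t b)) ∧
  ∃ V : L →ₗ[k] B, st.IsBimodMap V ∧ st.cconv cop U V = cou ∧ st.cconv cop V U = cou

/-- Convolution product on `B`-bimodule maps `L ⊗_{B^e} L → B`:
`(f ⋆ g)(X,Y) = f(X₍₁₎,Y₍₁₎) g(X₍₂₎,Y₍₂₎)`. -/
def conv2 (f g : L → L → B) (X Y : L) : B :=
  st.lift2 (fun y1 y2 =>
    st.lift2 (fun x1 x2 => f x1 y1 * g x2 y2) (cop X)) (cop Y)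

/-- The unit `ε̃(X ⊗ Y) = ε(XY)` of the convolution algebra. -/
def unit2 (X Y : L) : B := cou (X * Y)

/-- Left-hand side of the 2-cocycle condition: `Γ(X, s(Γ(Y₍₁₎,Z₍₁₎)) Y₍₂₎Z₍₂₎)`. -/
def cocL (Γ : L → L → B) (X Y Z : L) : B :=
  st.lift2 (fun z1 z2 =>
    st.lift2 (fun y1 y2 => Γ X (st.s (Γ y1 z1) * (y2 * z2))) (cop Y)) (cop Z)

/-- Right-hand side of the 2-cocycle condition: `Γ(s(Γ(X₍₁₎,Y₍₁₎)) X₍₂₎Y₍₂₎, Z)`. -/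
def cocR (Γ : L → L → B) (X Y Z : L) : B :=
  st.lift2 (fun y1 y2 =>
    st.lift2 (fun x1 x2 => Γ (st.s (Γ x1 y1) * (x2 * y2)) Z) (cop X)) (cop Y)

/-- Membership of a bilinear map in `_B Hom_B (L ⊗_{B^e} L, B)`. -/
def IsBihom (Γ : L → L → B) : Prop :=
  (∃ Γ' : L →ₗ[k] L →ₗ[k] B, ∀ X Y, Γ' X Y = Γ X Y) ∧
  (∀ (b c : B) (X Y : L), Γ (st.s b * (st.t c * X)) Y = b * Γ X Y * c) ∧
  (∀ (b c : B) (X Y : L), Γ (X * st.s b * st.t c) Y = Γ X (st.s b * (st.t c * Y)))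

/-- An invertible normalised 2-cocycle on a left bialgebroid (Definition 2.6);
the collection of these is `Z²(L,B)`. -/
structure IsZ2 (Γ : L → L → B) : Prop where
  bihom : st.IsBihom Γ
  norm_left : ∀ X : L, Γ 1 X = cou X
  norm_right : ∀ X : L, Γ X 1 = cou X
  st_indep : ∀ (b : B) (X Y : L), Γ X (Y * st.s b) = Γ X (Y * st.t b)
  cocycle : ∀ X Y Z : L, st.cocL cop Γ X Y Z = st.cocR cop Γ X Y Z
  inv : ∃ Γi : L → L → B, st.IsBihom Γi ∧
    (∀ X Y, st.conv2 cop Γ Γi X Y = unit2 cou X Y) ∧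
    (∀ X Y, st.conv2 cop Γi Γ X Y = unit2 cou X Y)

/-- The coboundary `∂U(X,Y) = U⁻¹(X₍₁₎ t(U⁻¹(Y₍₁₎))) U(X₍₂₎Y₍₂₎)` of `U ∈ C¹(L,B)`. -/
def coboundary (U Ui : L →ₗ[k] B) (X Y : L) : B :=
  st.lift2 (fun y1 y2 =>
    st.lift2 (fun x1 x2 => Ui (x1 * st.t (Ui y1)) * U (x2 * y2)) (cop X)) (cop Y)

/-- The transform `Γ^U(X,Y) = U⁻¹(X₍₁₎ t(U⁻¹(Y₍₁₎))) Γ(X₍₂₎,Y₍₂₎) U(X₍₃₎Y₍₃₎)`. -/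
def gammaU (Γ : L → L → B) (U Ui : L →ₗ[k] B) (X Y : L) : B :=
  st.lift2 (fun y1 y23 => st.lift2 (fun y2 y3 =>
    st.lift2 (fun x1 x23 => st.lift2 (fun x2 x3 =>
      Ui (x1 * st.t (Ui y1)) * Γ x2 y2 * U (x3 * y3)) (cop x23)) (cop X))
    (cop y23)) (cop Y)

/-- The cotwisted product `X ·_Γ Y := s(Γ(X₍₁₎,Y₍₁₎)) t(Γ⁻¹(X₍₃₎,Y₍₃₎)) X₍₂₎Y₍₂₎`. -/
def prodG (Γ Γi : L → L → B) (X Y : L) : L :=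
  st.lift2 (fun y1 y23 => st.lift2 (fun y2 y3 =>
    st.lift2 (fun x1 x23 => st.lift2 (fun x2 x3 =>
      st.s (Γ x1 y1) * (st.t (Γi x3 y3) * (x2 * y2))) (cop x23)) (cop X))
    (cop y23)) (cop Y)

/-- `Ad_U(X) := s(U(X₍₁₎)) t(U⁻¹(X₍₃₎)) X₍₂₎`. -/
def adU (U Ui : L →ₗ[k] B) (X : L) : L :=
  st.lift2 (fun x1 x23 => st.lift2 (fun x2 x3 =>
    st.s (U x1) * (st.t (Ui x3) * x2)) (cop x23)) (cop X)

end BgdST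

end

/-! ## Crossed (Drinfeld–Yetter) module algebras and action Hopf algebroids -/

noncomputable section
attribute [local instance] Classical.propDecidable

universe u v

open scoped TensorProduct
open TensorProduct

variable {k : Type u} [Field k] {H : Type v} [Ring H] [HopfAlgebra k H]
  {B : Type v} [Ring B] [Algebra k B]

/-- A right-right `H`-crossed (Drinfeld–Yetter) module algebra structure on `B`, given by a
right action `act` and a right coaction `coact`. -/
def IsRRCrossed (act : B → H → B) (coact : B → B ⊗[k] H) : Prop :=
  (∃ act' : B →ₗ[k] H →ₗ[k] B, ∀ (b : B) (h : H), act' b h = act b h) ∧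
  (∃ coact' : B →ₗ[k] B ⊗[k] H, ∀ b : B, coact' b = coact b) ∧
  (∀ b : B, act b 1 = b) ∧
  (∀ (b : B) (g h : H), act (act b g) h = act b (g * h)) ∧
  (∀ h : H, act 1 h = algebraMap k B (Coalgebra.counit (R := k) h)) ∧
  (∀ (a b : B) (h : H), act (a * b) h =
    tlift k (fun h1 h2 => act a h1 * act b h2) (Coalgebra.comul (R := k) h)) ∧
  (coact 1 = 1) ∧
  (∀ a b : B, coact (a * b) = coact a * coact b) ∧
  (∀ b : B,
    tlift k (fun b0 b1 => (b0 ⊗ₜ[k] (Coalgebra.comul (R := k) b1) : B ⊗[k] (H ⊗[k] H)))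
      (coact b) =
    tlift k (fun b0 b1 => tlift k (fun c0 c1 => (c0 ⊗ₜ[k] (c1 ⊗ₜ[k] b1) : B ⊗[k] (H ⊗[k] H)))
      (coact b0)) (coact b)) ∧
  (∀ b : B, tlift k (fun b0 b1 => (Coalgebra.counit (R := k) b1 : k) • b0) (coact b) = b) ∧
  -- the Drinfeld–Yetter compatibility  (a ◁ h₂)₀ ⊗ h₁(a ◁ h₂)₁ = (a₀ ◁ h₁) ⊗ a₁h₂
  (∀ (a : B) (h : H),
    tlift k (fun h1 h2 => tlift k (fun c0 c1 => c0 ⊗ₜ[k] (h1 * c1)) (coact (act a h2)))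
      (Coalgebra.comul (R := k) h) =
    tlift k (fun b0 b1 => tlift k (fun h1 h2 => act b0 h1 ⊗ₜ[k] (b1 * h2))
      (Coalgebra.comul (R := k) h)) (coact a))

/-- Braided commutativity `a b = b₀ (a ◁ b₁)`. -/
def IsBraidedComm (act : B → H → B) (coact : B → B ⊗[k] H) : Prop :=
  ∀ a b : B, a * b = tlift k (fun b0 b1 => b0 * act a b1) (coact b)

/-- The smash product multiplication `(a # h)(b # g) = a (b ◁ h₁) # g h₂` on `B ⊗ H`. -/
def smashMul (act : B → H → B) (z w : B ⊗[k] H) : B ⊗[k] H :=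
  tlift k (fun a h => tlift k (fun b g => tlift k (fun h1 h2 =>
    (a * act b h1) ⊗ₜ[k] (g * h2)) (Coalgebra.comul (R := k) h)) w) z

/-- `ψ(b) = b₀ ϱ(b₁)` for `ϱ : H → B`. -/
def psiFun (coact : B → B ⊗[k] H) (ϱ : H → B) (b : B) : B :=
  tlift k (fun b0 b1 => b0 * ϱ b1) (coact b)

/-- `Z¹_◁(H,B)`: unital maps `ϱ : H → B` with `ϱ(gh) = (ϱ(g) ◁ h₁) ϱ(h₂)` and `ψ` bijective. -/
def IsZ1cross (act : B → H → B) (coact : B → B ⊗[k] H) (ϱ : H →ₗ[k] B) : Prop :=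
  ϱ 1 = 1 ∧
  (∀ g h : H, ϱ (g * h) =
    tlift k (fun h1 h2 => act (ϱ g) h1 * ϱ h2) (Coalgebra.comul (R := k) h)) ∧
  Function.Bijective (psiFun coact (⇑ϱ))

/-- The group product `(ϱ • ϱ')(h) = ϱ(h₁) ψ(ϱ'(h₂))` on `Z¹_◁(H,B)`. -/
def bulletFun (coact : B → B ⊗[k] H) (ϱ ϱ' : H → B) (h : H) : B :=
  tlift k (fun h1 h2 => ϱ h1 * psiFun coact ϱ (ϱ' h2)) (Coalgebra.comul (R := k) h)

/-- The unit `h ↦ ε(h)1`. -/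
def unitBmap : H →ₗ[k] B :=
  (Algebra.linearMap k B).comp (Coalgebra.counit (R := k) (A := H))

/-- Convolution of linear maps `H → B`. -/
def convHB (f g : H →ₗ[k] B) : H →ₗ[k] B :=
  (tlift k (fun h1 h2 => f h1 * g h2)).comp (Coalgebra.comul (R := k) (A := H))

/-- Convolution of maps `H ⊗ H → B`. -/
def convBB (γ δ : H → H → B) (h g : H) : B :=
  tlift k (fun h1 h2 => tlift k (fun g1 g2 => γ h1 g1 * δ h2 g2)
    (Coalgebra.comul (R := k) g)) (Coalgebra.comul (R := k) h)

/-- `Z²_{◁,as}(H,B)`: convolution-invertible 2-cocycles of associative type. -/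
def IsZ2as (act : B → H → B) (γ : H → H → B) : Prop :=
  (∃ γ' : H →ₗ[k] H →ₗ[k] B, ∀ h g, γ' h g = γ h g) ∧
  (∀ h : H, γ h 1 = algebraMap k B (Coalgebra.counit (R := k) h) ∧
    γ 1 h = algebraMap k B (Coalgebra.counit (R := k) h)) ∧
  (∀ h g f : H,
    tlift k (fun h1 h2 => tlift k (fun g1 g2 => tlift k (fun f1 f2 =>
      act (γ g1 f1) h1 * γ h2 (f2 * g2)) (Coalgebra.comul (R := k) f))
        (Coalgebra.comul (R := k) g)) (Coalgebra.comul (R := k) h) =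
    tlift k (fun h1 h2 => tlift k (fun g1 g2 =>
      γ h1 g1 * γ (g2 * h2) f) (Coalgebra.comul (R := k) g)) (Coalgebra.comul (R := k) h)) ∧
  (∀ (h g : H) (b : B),
    tlift k (fun h1 h2 => tlift k (fun g1 g2 => γ h1 g1 * act b (g2 * h2))
      (Coalgebra.comul (R := k) g)) (Coalgebra.comul (R := k) h) =
    tlift k (fun h1 h2 => tlift k (fun g1 g2 => act b (g1 * h1) * γ h2 g2)
      (Coalgebra.comul (R := k) g)) (Coalgebra.comul (R := k) h)) ∧
  (∃ γi : H → H → B, (∃ γi' : H →ₗ[k] H →ₗ[k] B, ∀ h g, γi' h g = γi h g) ∧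
    (∀ h g : H, convBB (k := k) γ γi h g =
      algebraMap k B (Coalgebra.counit (R := k) h * Coalgebra.counit (R := k) g)) ∧
    (∀ h g : H, convBB (k := k) γi γ h g =
      algebraMap k B (Coalgebra.counit (R := k) h * Coalgebra.counit (R := k) g)))

/-- `Z²_◁(H,B)`: the subset of `Z²_{◁,as}(H,B)` satisfying the two extra conditions. -/
def IsZ2cross (act : B → H → B) (coact : B → B ⊗[k] H) (γ : H → H → B) : Prop :=
  IsZ2as (k := k) act γ ∧
  (∀ (h g : H) (c : B),
    tlift k (fun h1 h2 => γ h1 g * act c h2) (Coalgebra.comul (R := k) h) =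
    tlift k (fun c0 c1 => tlift k (fun h1 h2 => act c0 h1 * γ h2 (g * c1))
      (Coalgebra.comul (R := k) h)) (coact c)) ∧
  (∀ (h g : H) (c : B),
    tlift k (fun c0 c1 => c0 * γ (h * c1) g) (coact c) = γ h g * c)

/-- `C¹_{◁,ver}(H,B)`: unital convolution-invertible maps `ϱ : H → B` with
`b₀ ϱ(h b₁) = ϱ(h) b` and `ϱ(h₁)(b ◁ h₂) = (b ◁ h₁) ϱ(h₂)`. -/
def IsC1ver (act : B → H → B) (coact : B → B ⊗[k] H) (ϱ : H →ₗ[k] B) : Prop :=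
  ϱ 1 = 1 ∧
  (∀ (h : H) (b : B), tlift k (fun b0 b1 => b0 * ϱ (h * b1)) (coact b) = ϱ h * b) ∧
  (∀ (h : H) (b : B),
    tlift k (fun h1 h2 => ϱ h1 * act b h2) (Coalgebra.comul (R := k) h) =
    tlift k (fun h1 h2 => act b h1 * ϱ h2) (Coalgebra.comul (R := k) h)) ∧
  ∃ ϱi : H →ₗ[k] B, convHB ϱ ϱi = unitBmap ∧ convHB ϱi ϱ = unitBmap

/-- `γ^ϱ(h,g) = ϱ⁻¹(h₁)(ϱ⁻¹(g₁) ◁ h₂) γ(h₃, g₂) ϱ(g₃ h₄)`. -/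
def gamRho (act : B → H → B) (ϱ ϱi : H → B) (γ : H → H → B) (h g : H) : B :=
  tlift k (fun h1 h234 => tlift k (fun h2 h34 => tlift k (fun h3 h4 =>
    tlift k (fun g1 g23 => tlift k (fun g2 g3 =>
      ϱi h1 * act (ϱi g1) h2 * γ h3 g2 * ϱ (g3 * h4)) (Coalgebra.comul (R := k) g23))
      (Coalgebra.comul (R := k) g))
    (Coalgebra.comul (R := k) h34)) (Coalgebra.comul (R := k) h234))
    (Coalgebra.comul (R := k) h)

/-- The value `Γ_γ(a # h, b # g) = a (b ◁ h₁) γ(h₂, g)` computed through `ψ`. -/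
def gammaSmash {L0 : Type v} [AddCommGroup L0] [Module k L0]
    (act : B → H → B) (ψ : L0 ≃ₗ[k] B ⊗[k] H) (γ : H → H → B) (z w : L0) : B :=
  tlift k (fun a h => tlift k (fun b g => tlift k (fun h1 h2 =>
    a * act b h1 * γ h2 g) (Coalgebra.comul (R := k) h)) (ψ w)) (ψ z)

end

section ActionBialgebroid

open Coalgebra

section Lifts

variable {R : Type*} [CommRing R] {M N Q : Type*} [AddCommGroup M] [Module R M]
  [AddCommGroup N] [Module R N] [AddCommGroup Q] [Module R Q]

theorem tlift_eq {f : M → N → Q} (F : M ⊗[R] N →ₗ[R] Q) (h : ∀ x y, F (x ⊗ₜ[R] y) = f x y) :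
    tlift R f = F := by
  have hex : ∃ F : M ⊗[R] N →ₗ[R] Q, ∀ x y, F (x ⊗ₜ[R] y) = f x y := ⟨F, h⟩
  rw [tlift, dif_pos hex]
  exact TensorProduct.ext' fun x y => (hex.choose_spec x y).trans (h x y).symm

theorem tlift_apply_tmul {f : M → N → Q} (F : M →ₗ[R] N →ₗ[R] Q) (h : ∀ x y, F x y = f x y)
    (x : M) (y : N) : tlift R f (x ⊗ₜ[R] y) = f x y := by
  rw [tlift_eq (TensorProduct.lift F) (by simpa using h), TensorProduct.lift.tmul, h]

theorem qtlift_eq {p : Submodule R (M ⊗[R] N)} {f : M → N → Q}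
    (F : ((M ⊗[R] N) ⧸ p) →ₗ[R] Q)
    (h : ∀ x y, F (Submodule.Quotient.mk (x ⊗ₜ[R] y)) = f x y) : qtlift R p f = F := by
  have hex : ∃ F : ((M ⊗[R] N) ⧸ p) →ₗ[R] Q,
      ∀ x y, F (Submodule.Quotient.mk (x ⊗ₜ[R] y)) = f x y := ⟨F, h⟩
  rw [qtlift, dif_pos hex]
  refine Submodule.linearMap_qext _ (TensorProduct.ext' fun x y => ?_)
  exact (hex.choose_spec x y).trans (h x y).symm

end Lifts

section Twists

variable {k : Type*} [CommRing k] {H : Type*} [Ring H] [HopfAlgebra k H]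

/-- The map `h ⊗ g ↦ h₁ ⊗ g f(h₂)`. -/
def rightTwist (f : H →ₗ[k] H) : H ⊗[k] H →ₗ[k] H ⊗[k] H :=
  (LinearMap.lTensor H (LinearMap.mul' k H ∘ₗ (TensorProduct.comm k H H).toLinearMap ∘ₗ
    LinearMap.rTensor H f)) ∘ₗ (TensorProduct.assoc k H H H).toLinearMap ∘ₗ
    LinearMap.rTensor H comul

/-- The map `g ⊗ h ↦ g f(h₁) ⊗ h₂`. -/
def leftTwist (f : H →ₗ[k] H) : H ⊗[k] H →ₗ[k] H ⊗[k] H :=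
  (LinearMap.rTensor H (LinearMap.mul' k H ∘ₗ LinearMap.lTensor H f)) ∘ₗ
    (TensorProduct.assoc k H H H).symm.toLinearMap ∘ₗ LinearMap.lTensor H comul

theorem rightTwist_tmul (f : H →ₗ[k] H) (h g : H) :
    rightTwist f (h ⊗ₜ[k] g) =
      LinearMap.lTensor H (LinearMap.mulLeft k g ∘ₗ f) (comul (R := k) h) := by
  simp only [rightTwist, LinearMap.comp_apply, LinearMap.rTensor_tmul, LinearEquiv.coe_coe]
  induction comul (R := k) h with
  | zero => simp
  | tmul x y => simp
  | add x y hx hy => simp only [add_tmul, map_add, hx, hy]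

theorem leftTwist_tmul (f : H →ₗ[k] H) (g h : H) :
    leftTwist f (g ⊗ₜ[k] h) =
      LinearMap.rTensor H (LinearMap.mulLeft k g ∘ₗ f) (comul (R := k) h) := by
  simp only [leftTwist, LinearMap.comp_apply, LinearMap.lTensor_tmul, LinearEquiv.coe_coe]
  induction comul (R := k) h with
  | zero => simp
  | tmul x y => simp
  | add x y hx hy => simp only [tmul_add, map_add, hx, hy]

/-- If `W(h₁ ⊗ h₂) = ε(h)1`, then `n₀ ⊗ W(n₁ ⊗ n₂) = n ⊗ 1` in any right comodule. -/
theorem comodule_contract {N : Type*} [AddCommGroup N] [Module k N] {ρ : N →ₗ[k] N ⊗[k] H}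
    (hassoc : ∀ n, TensorProduct.assoc k N H H (LinearMap.rTensor H ρ (ρ n)) =
      LinearMap.lTensor N comul (ρ n))
    (hcounit : ∀ n, LinearMap.lTensor N (counit (R := k) (A := H)) (ρ n) = n ⊗ₜ[k] (1 : k))
    {W : H ⊗[k] H →ₗ[k] H} (hW : W ∘ₗ comul = Algebra.linearMap k H ∘ₗ counit) (n : N) :
    LinearMap.lTensor N W (TensorProduct.assoc k N H H (LinearMap.rTensor H ρ (ρ n))) =
      n ⊗ₜ[k] (1 : H) := by
  rw [hassoc, ← LinearMap.comp_apply, ← LinearMap.lTensor_comp, hW, LinearMap.lTensor_comp,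
    LinearMap.comp_apply, hcounit]
  simp

theorem comul_contract_right {W : H ⊗[k] H →ₗ[k] H}
    (hW : W ∘ₗ comul = Algebra.linearMap k H ∘ₗ counit) (h : H) :
    LinearMap.lTensor H W (TensorProduct.assoc k H H H
      (LinearMap.rTensor H comul (comul (R := k) h))) = h ⊗ₜ[k] (1 : H) :=
  comodule_contract (ρ := comul (R := k) (A := H)) coassoc_apply lTensor_counit_comul hW h

theorem comul_contract_left {W : H ⊗[k] H →ₗ[k] H}
    (hW : W ∘ₗ comul = Algebra.linearMap k H ∘ₗ counit) (h : H) :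
    LinearMap.rTensor H W ((TensorProduct.assoc k H H H).symm
      (LinearMap.lTensor H comul (comul (R := k) h))) = (1 : H) ⊗ₜ[k] h := by
  rw [coassoc_symm_apply, ← LinearMap.comp_apply, ← LinearMap.rTensor_comp, hW,
    LinearMap.rTensor_comp, LinearMap.comp_apply, rTensor_counit_comul]
  simp

theorem rightTwist_rightTwist {f f' : H →ₗ[k] H}
    (hW : (LinearMap.mul' k H ∘ₗ TensorProduct.map f' f ∘ₗ
      (TensorProduct.comm k H H).toLinearMap) ∘ₗ comul = Algebra.linearMap k H ∘ₗ counit)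
    (z : H ⊗[k] H) : rightTwist f (rightTwist f' z) = z := by
  induction z with
  | zero => simp
  | add x y hx hy => simp only [map_add, hx, hy]
  | tmul h g =>
    have key : ∀ u : H ⊗[k] H,
        rightTwist f (LinearMap.lTensor H (LinearMap.mulLeft k g ∘ₗ f') u) =
        LinearMap.lTensor H (LinearMap.mulLeft k g)
          (LinearMap.lTensor H (LinearMap.mul' k H ∘ₗ TensorProduct.map f' f ∘ₗ
            (TensorProduct.comm k H H).toLinearMap)
            (TensorProduct.assoc k H H H (LinearMap.rTensor H comul u))) := by
      intro u
      induction u with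
      | zero => simp
      | add x y hx hy => simp only [map_add, hx, hy]
      | tmul x z =>
        simp only [LinearMap.lTensor_tmul, LinearMap.rTensor_tmul, rightTwist_tmul]
        induction comul (R := k) x with
        | zero => simp
        | tmul x y => simp
        | add x y hx hy => simp only [add_tmul, map_add, hx, hy]
    rw [rightTwist_tmul, key, comul_contract_right hW]
    simp

theorem leftTwist_leftTwist {f f' : H →ₗ[k] H}
    (hW : (LinearMap.mul' k H ∘ₗ TensorProduct.map f' f) ∘ₗ comul =
      Algebra.linearMap k H ∘ₗ counit)
    (z : H ⊗[k] H) : leftTwist f (leftTwist f' z) = z := by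
  induction z with
  | zero => simp
  | add x y hx hy => simp only [map_add, hx, hy]
  | tmul g h =>
    have key : ∀ u : H ⊗[k] H,
        leftTwist f (LinearMap.rTensor H (LinearMap.mulLeft k g ∘ₗ f') u) =
        LinearMap.rTensor H (LinearMap.mulLeft k g)
          (LinearMap.rTensor H (LinearMap.mul' k H ∘ₗ TensorProduct.map f' f)
            ((TensorProduct.assoc k H H H).symm (LinearMap.lTensor H comul u))) := by
      intro u
      induction u with
      | zero => simp
      | add x y hx hy => simp only [map_add, hx, hy]
      | tmul x z =>
        simp only [LinearMap.lTensor_tmul, LinearMap.rTensor_tmul, leftTwist_tmul]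
        induction comul (R := k) z with
        | zero => simp
        | tmul x y => simp
        | add x y hx hy => simp only [tmul_add, map_add, hx, hy]
    rw [leftTwist_tmul, key, comul_contract_left hW]
    simp

theorem lTensor_bijective_of_inverse {N M : Type*} [AddCommGroup N] [Module k N]
    [AddCommGroup M] [Module k M] {f g : M →ₗ[k] M} (hfg : ∀ z, f (g z) = z)
    (hgf : ∀ z, g (f z) = z) : Function.Bijective (LinearMap.lTensor N f) :=
  (LinearEquiv.lTensor N
    (LinearEquiv.ofLinearMap f g (LinearMap.ext hfg) (LinearMap.ext hgf))).bijective

theorem mul_map_antipode_id :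
    (LinearMap.mul' k H ∘ₗ TensorProduct.map (HopfAlgebra.antipode k) LinearMap.id) ∘ₗ comul =
      Algebra.linearMap k H ∘ₗ counit :=
  HopfAlgebra.mul_antipode_rTensor_comul

theorem mul_map_id_antipode :
    (LinearMap.mul' k H ∘ₗ TensorProduct.map LinearMap.id (HopfAlgebra.antipode k)) ∘ₗ comul =
      Algebra.linearMap k H ∘ₗ counit :=
  HopfAlgebra.mul_antipode_lTensor_comul

theorem comp_comul_eq_of_antipode_comp {T : H →ₗ[k] H}
    (hT' : T ∘ₗ HopfAlgebra.antipode k = LinearMap.id) {W V : H ⊗[k] H →ₗ[k] H}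
    (hWV : HopfAlgebra.antipode k ∘ₗ W = V)
    (hV : V ∘ₗ comul = Algebra.linearMap k H ∘ₗ counit) :
    W ∘ₗ comul = Algebra.linearMap k H ∘ₗ counit := by
  have h1 : T (1 : H) = 1 := by simpa using LinearMap.congr_fun hT' (1 : H)
  have h2 : T ∘ₗ V = W := by
    rw [← hWV, ← LinearMap.comp_assoc, hT', LinearMap.id_comp]
  rw [← h2, LinearMap.comp_assoc, hV]
  ext h
  simp [Algebra.algebraMap_eq_smul_one, h1]

/-- The inverse antipode satisfies `S⁻¹(h₂) h₁ = ε(h)1`. -/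
theorem mul_map_inv_id_comm {T : H →ₗ[k] H} (hT : HopfAlgebra.antipode k ∘ₗ T = LinearMap.id)
    (hT' : T ∘ₗ HopfAlgebra.antipode k = LinearMap.id) :
    (LinearMap.mul' k H ∘ₗ TensorProduct.map T LinearMap.id ∘ₗ
      (TensorProduct.comm k H H).toLinearMap) ∘ₗ comul = Algebra.linearMap k H ∘ₗ counit := by
  refine comp_comul_eq_of_antipode_comp hT' (TensorProduct.ext' fun x y => ?_)
    mul_map_antipode_id
  simpa [HopfAlgebra.antipode_mul_antidistrib] using
    congrArg (HopfAlgebra.antipode k x * ·) (LinearMap.congr_fun hT y)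

/-- The inverse antipode satisfies `h₂ S⁻¹(h₁) = ε(h)1`. -/
theorem mul_map_id_inv_comm {T : H →ₗ[k] H} (hT : HopfAlgebra.antipode k ∘ₗ T = LinearMap.id)
    (hT' : T ∘ₗ HopfAlgebra.antipode k = LinearMap.id) :
    (LinearMap.mul' k H ∘ₗ TensorProduct.map LinearMap.id T ∘ₗ
      (TensorProduct.comm k H H).toLinearMap) ∘ₗ comul = Algebra.linearMap k H ∘ₗ counit := by
  refine comp_comul_eq_of_antipode_comp hT' (TensorProduct.ext' fun x y => ?_)
    mul_map_id_antipode
  simpa [HopfAlgebra.antipode_mul_antidistrib] using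
    congrArg (· * HopfAlgebra.antipode k y) (LinearMap.congr_fun hT x)

end Twists

namespace BgdST

variable {k : Type*} [Field k] {B L : Type*} [Ring B] [Algebra k B] [Ring L] [Algebra k L]
  (st : BgdST k B L)

/-- Factorwise right multiplication of `L ⊗_B L` by `L ⊗ L`. -/
def rmul : st.T2 →ₗ[k] L ⊗[k] L →ₗ[k] st.T2 :=
  st.rel.liftQ ((LinearMap.mul k (L ⊗[k] L)).compr₂ st.rel.mkQ) <| by
    refine Submodule.span_le.2 ?_
    rintro _ ⟨a, X, Y, rfl⟩
    refine TensorProduct.ext' fun U V => ?_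
    refine (Submodule.Quotient.mk_eq_zero _).2 (Submodule.subset_span ⟨a, X * U, Y * V, ?_⟩)
    simp [mul_assoc]

theorem rmul_mk (z w : L ⊗[k] L) :
    st.rmul (Submodule.Quotient.mk z) w = Submodule.Quotient.mk (z * w) := rfl

theorem rmul_mk2 (X Y U V : L) : st.rmul (st.mk2 X Y) (U ⊗ₜ V) = st.mk2 (X * U) (Y * V) := by
  simp [mk2, rmul_mk]

theorem rmul_rmul (z : st.T2) (w w' : L ⊗[k] L) :
    st.rmul (st.rmul z w) w' = st.rmul z (w * w') := by
  obtain ⟨z, rfl⟩ := Submodule.Quotient.mk_surjective _ z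
  simp [rmul_mk, mul_assoc]

theorem mk2_t_mul (a : B) (X Y : L) : st.mk2 (st.t a * X) Y = st.mk2 X (st.s a * Y) :=
  (Submodule.Quotient.eq _).2 (Submodule.subset_span ⟨a, X, Y, rfl⟩)

theorem mkOp_mul_t (a : B) (X Y : L) : st.mkOp (X * st.t a) Y = st.mkOp X (st.t a * Y) :=
  (Submodule.Quotient.eq _).2 (Submodule.subset_span ⟨a, X, Y, rfl⟩)

theorem mkA_s_mul (a : B) (X Y : L) : st.mkA (st.s a * X) Y = st.mkA X (Y * st.s a) :=
  (Submodule.Quotient.eq _).2 (Submodule.subset_span ⟨a, X, Y, rfl⟩)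

theorem lift2_eq {Q : Type*} [AddCommGroup Q] [Module k Q] {f : L → L → Q}
    (F : st.T2 →ₗ[k] Q) (h : ∀ x y, F (st.mk2 x y) = f x y) : st.lift2 f = F :=
  qtlift_eq F h

theorem lift2_mul_mul (U V : L) :
    st.lift2 (fun x y => st.mk2 (x * U) (y * V)) = st.rmul.flip (U ⊗ₜ V) :=
  st.lift2_eq _ fun x y => st.rmul_mk2 x y U V

theorem lift2_mul_right (V : L) :
    st.lift2 (fun x y => st.mk2 x (y * V)) = st.rmul.flip (1 ⊗ₜ V) := by
  simpa using st.lift2_mul_mul 1 V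

theorem lift2_mul_left (U : L) :
    st.lift2 (fun x y => st.mk2 (x * U) y) = st.rmul.flip (U ⊗ₜ 1) := by
  simpa using st.lift2_mul_mul U 1

namespace IsLeftBialgebroid

variable {st} {cop : L →ₗ[k] st.T2} {cou : L →ₗ[k] B}

theorem rmul_takeuchi (hL : st.IsLeftBialgebroid cop cou) (b : B) (X : L) :
    st.rmul (cop X) (st.t b ⊗ₜ 1) = st.rmul (cop X) (1 ⊗ₜ st.s b) := by
  have := hL.takeuchi b X
  rwa [lift2_mul_right, lift2_mul_left] at this

theorem rmul_eq_zero_of_mem (hL : st.IsLeftBialgebroid cop cou) (X : L) {w : L ⊗[k] L}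
    (hw : w ∈ st.rel) :
    st.rmul (cop X) w = 0 := by
  suffices st.rel ≤ LinearMap.ker (st.rmul (cop X)) from this hw
  refine Submodule.span_le.2 ?_
  rintro _ ⟨a, U, V, rfl⟩
  have h1 : (st.t a * U) ⊗ₜ[k] V = (st.t a ⊗ₜ 1) * (U ⊗ₜ[k] V) := by simp
  have h2 : U ⊗ₜ[k] (st.s a * V) = (1 ⊗ₜ st.s a) * (U ⊗ₜ[k] V) := by simp
  simp only [SetLike.mem_coe, LinearMap.mem_ker, map_sub]
  rw [h1, h2, ← rmul_rmul, ← rmul_rmul, hL.rmul_takeuchi, sub_self]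

theorem mulT2_cop (hL : st.IsLeftBialgebroid cop cou) (X : L) (w : L ⊗[k] L) :
    st.mulT2 (cop X) (Submodule.Quotient.mk w) = st.rmul (cop X) w := by
  have hex : ∃ u : st.T2, ∀ zr wr : L ⊗[k] L, Submodule.Quotient.mk zr = cop X →
      Submodule.Quotient.mk wr = (Submodule.Quotient.mk w : st.T2) →
        Submodule.Quotient.mk (zr * wr) = u := by
    refine ⟨st.rmul (cop X) w, fun zr wr hz hw => ?_⟩
    rw [← rmul_mk, hz, ← sub_eq_zero, ← map_sub]
    exact hL.rmul_eq_zero_of_mem X ((Submodule.Quotient.eq _).1 hw)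
  obtain ⟨z, hz⟩ := Submodule.Quotient.mk_surjective _ (cop X)
  rw [mulT2, dif_pos hex, ← hex.choose_spec z w hz rfl, ← rmul_mk, hz]

theorem cop_mul_of_eq (hL : st.IsLeftBialgebroid cop cou) {X Y U V : L} (h : cop Y = st.mk2 U V) :
    cop (X * Y) = st.rmul (cop X) (U ⊗ₜ V) := by
  rw [hL.comul_mul, h, mk2, hL.mulT2_cop]

theorem cop_s (hL : st.IsLeftBialgebroid cop cou) (b : B) : cop (st.s b) = st.mk2 (st.s b) 1 := by
  have h := hL.comul_s b 1
  rw [mul_one, hL.comul_one] at h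
  have hle : st.rel ≤ st.rel.comap (LinearMap.rTensor L (LinearMap.mulLeft k (st.s b))) := by
    refine Submodule.span_le.2 ?_
    rintro _ ⟨a, X, Y, rfl⟩
    refine Submodule.subset_span ⟨a, st.s b * X, Y, ?_⟩
    simp [← mul_assoc, st.st_comm]
  rw [st.lift2_eq
    (f := fun x y => st.mk2 (st.s b * x) y) (st.rel.mapQ st.rel _ hle) fun x y => rfl] at h
  simpa [mk2] using h

theorem cop_t (hL : st.IsLeftBialgebroid cop cou) (b : B) : cop (st.t b) = st.mk2 1 (st.t b) := by
  have h := hL.comul_t b 1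
  rw [mul_one, hL.comul_one] at h
  have hle : st.rel ≤ st.rel.comap (LinearMap.lTensor L (LinearMap.mulLeft k (st.t b))) := by
    refine Submodule.span_le.2 ?_
    rintro _ ⟨a, X, Y, rfl⟩
    refine Submodule.subset_span ⟨a, X, st.t b * Y, ?_⟩
    simp [← mul_assoc, st.st_comm]
  rw [st.lift2_eq
    (f := fun x y => st.mk2 x (st.t b * y)) (st.rel.mapQ st.rel _ hle) fun x y => rfl] at h
  simpa [mk2] using h

theorem lam_mkOp (hL : st.IsLeftBialgebroid cop cou) (X Y : L) :
    st.lam cop (st.mkOp X Y) = st.rmul (cop X) (1 ⊗ₜ Y) := by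
  let F : L ⊗[k] L →ₗ[k] st.T2 :=
    TensorProduct.lift ((st.rmul ∘ₗ cop).compl₂ (TensorProduct.mk k L L 1))
  have hF : st.relOp ≤ LinearMap.ker F := by
    refine Submodule.span_le.2 ?_
    rintro _ ⟨a, X, Y, rfl⟩
    simp [F, hL.cop_mul_of_eq (hL.cop_t a), rmul_rmul]
  have : st.lam cop = st.relOp.liftQ F hF := by
    refine qtlift_eq _ fun X Y => ?_
    rw [lift2_mul_right]
    simp [F]
  rw [this]
  simp [mkOp, F]

theorem mu_mkA (hL : st.IsLeftBialgebroid cop cou) (X Y : L) :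
    st.mu cop (st.mkA X Y) = st.rmul (cop Y) (X ⊗ₜ 1) := by
  let F : L ⊗[k] L →ₗ[k] st.T2 :=
    TensorProduct.lift ((st.rmul ∘ₗ cop).compl₂ ((TensorProduct.mk k L L).flip 1)).flip
  have hF : st.relA ≤ LinearMap.ker F := by
    refine Submodule.span_le.2 ?_
    rintro _ ⟨a, X, Y, rfl⟩
    simp [F, hL.cop_mul_of_eq (hL.cop_s a), rmul_rmul]
  have : st.mu cop = st.relA.liftQ F hF := by
    refine qtlift_eq _ fun X Y => ?_
    rw [lift2_mul_left]
    simp [F]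
  rw [this]
  simp [mkA, F]

end IsLeftBialgebroid

section ActionPresentation

variable {H : Type*} [Ring H] [HopfAlgebra k H] (E : B ⊗[k] H ≃ₗ[k] L)

/-- The linear map `B ⊗ (H ⊗ H) → L ⊗_B L`, `a ⊗ (h ⊗ g) ↦ (a # h) ⊗_B (1 # g)`. -/
def smashT2 : B ⊗[k] (H ⊗[k] H) →ₗ[k] st.T2 :=
  st.rel.mkQ ∘ₗ TensorProduct.map E.toLinearMap (E.toLinearMap ∘ₗ TensorProduct.mk k B H 1) ∘ₗ
    (TensorProduct.assoc k B H H).symm.toLinearMap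

/-- The linear map `B ⊗ (H ⊗ H) → L ⊗_{B^{op}} L`, `a ⊗ (h ⊗ g) ↦ (a # h) ⊗ (1 # g)`. -/
def smashTOp : B ⊗[k] (H ⊗[k] H) →ₗ[k] st.TOp :=
  st.relOp.mkQ ∘ₗ TensorProduct.map E.toLinearMap (E.toLinearMap ∘ₗ TensorProduct.mk k B H 1) ∘ₗ
    (TensorProduct.assoc k B H H).symm.toLinearMap

/-- The linear map `B ⊗ (H ⊗ H) → L ⊗^{B^{op}} L`, `a ⊗ (g ⊗ h) ↦ (1 # g) ⊗ (a # h)`. -/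
def smashTA : B ⊗[k] (H ⊗[k] H) →ₗ[k] st.TA :=
  st.relA.mkQ ∘ₗ TensorProduct.map (E.toLinearMap ∘ₗ TensorProduct.mk k B H 1) E.toLinearMap ∘ₗ
    (TensorProduct.leftComm k B H H).toLinearMap

theorem smashT2_tmul (a : B) (h g : H) :
    st.smashT2 E (a ⊗ₜ (h ⊗ₜ g)) = st.mk2 (E (a ⊗ₜ h)) (E (1 ⊗ₜ g)) := by
  simp [smashT2, mk2]

theorem smashTOp_tmul (a : B) (h g : H) :
    st.smashTOp E (a ⊗ₜ (h ⊗ₜ g)) = st.mkOp (E (a ⊗ₜ h)) (E (1 ⊗ₜ g)) := by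
  simp [smashTOp, mkOp]

theorem smashTA_tmul (a : B) (g h : H) :
    st.smashTA E (a ⊗ₜ (g ⊗ₜ h)) = st.mkA (E (1 ⊗ₜ g)) (E (a ⊗ₜ h)) := by
  simp [smashTA, mkA]

variable {st} {E}

theorem smashT2_surjective (hs : ∀ (b a : B) (h : H), st.s b * E (a ⊗ₜ h) = E ((b * a) ⊗ₜ h)) :
    Function.Surjective (st.smashT2 E) := by
  have hgen : ∀ (X : L) (g : H), st.mk2 X (E (1 ⊗ₜ g)) ∈ LinearMap.range (st.smashT2 E) := by
    intro X g
    obtain ⟨X, rfl⟩ := E.surjective X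
    induction X with
    | zero => simp [mk2]
    | tmul a h => exact ⟨_, st.smashT2_tmul E a h g⟩
    | add x y hx hy => simpa [mk2, add_tmul] using add_mem hx hy
  have hpure : ∀ X Y : L, st.mk2 X Y ∈ LinearMap.range (st.smashT2 E) := by
    intro X Y
    obtain ⟨Y, rfl⟩ := E.surjective Y
    induction Y with
    | zero => simp [mk2]
    | tmul b g =>
      have := hgen (st.t b * X) g
      rwa [mk2_t_mul, hs, mul_one] at this
    | add x y hx hy => simpa [mk2, tmul_add] using add_mem hx hy
  intro z
  obtain ⟨z, rfl⟩ := Submodule.Quotient.mk_surjective _ z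
  change _ ∈ LinearMap.range (st.smashT2 E)
  induction z with
  | zero => exact zero_mem _
  | tmul X Y => exact hpure X Y
  | add x y hx hy => exact add_mem hx hy

/-- The map `L ⊗ L → L ⊗ H`, `X ⊗ (b # g) ↦ t(b) X ⊗ g`. -/
def tMulTensor (st : BgdST k B L) (E : B ⊗[k] H ≃ₗ[k] L) : L ⊗[k] L →ₗ[k] L ⊗[k] H :=
  LinearMap.rTensor H (TensorProduct.lift (LinearMap.mul k L ∘ₗ st.t).flip) ∘ₗ
    (TensorProduct.assoc k L B H).symm.toLinearMap ∘ₗ LinearMap.lTensor L E.symm.toLinearMap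

theorem tMulTensor_tmul (X : L) (b : B) (g : H) :
    tMulTensor st E (X ⊗ₜ E (b ⊗ₜ g)) = (st.t b * X) ⊗ₜ g := by
  simp [tMulTensor]

theorem smashT2_injective (hs : ∀ (b a : B) (h : H), st.s b * E (a ⊗ₜ h) = E ((b * a) ⊗ₜ h)) :
    Function.Injective (st.smashT2 E) := by
  have hle : st.rel ≤ LinearMap.ker (tMulTensor st E) := by
    refine Submodule.span_le.2 ?_
    rintro _ ⟨a, X, Y, rfl⟩
    obtain ⟨Y, rfl⟩ := E.surjective Y
    simp only [SetLike.mem_coe, LinearMap.mem_ker]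
    induction Y with
    | zero => simp
    | tmul b g => simp [hs, tMulTensor_tmul, st.t_mul, mul_assoc]
    | add x y hx hy =>
      simp only [map_add, mul_add, tmul_add, add_sub_add_comm, hx, hy, add_zero]
  let G : st.T2 →ₗ[k] B ⊗[k] (H ⊗[k] H) := (TensorProduct.assoc k B H H).toLinearMap ∘ₗ
    LinearMap.rTensor H E.symm.toLinearMap ∘ₗ st.rel.liftQ _ hle
  have hinv : G ∘ₗ st.smashT2 E = LinearMap.id := by
    ext a h g
    simp [G, smashT2_tmul, mk2, tMulTensor_tmul, st.t_one]
  exact Function.LeftInverse.injective (g := G) (LinearMap.congr_fun hinv)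

theorem smashTA_surjective (hs : ∀ (b a : B) (h : H), st.s b * E (a ⊗ₜ h) = E ((b * a) ⊗ₜ h)) :
    Function.Surjective (st.smashTA E) := by
  have hgen : ∀ (g : H) (Y : L), st.mkA (E (1 ⊗ₜ g)) Y ∈ LinearMap.range (st.smashTA E) := by
    intro g Y
    obtain ⟨Y, rfl⟩ := E.surjective Y
    induction Y with
    | zero => simp [mkA]
    | tmul a h => exact ⟨_, st.smashTA_tmul E a g h⟩
    | add x y hx hy => simpa [mkA, tmul_add] using add_mem hx hy
  have hpure : ∀ X Y : L, st.mkA X Y ∈ LinearMap.range (st.smashTA E) := by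
    intro X Y
    obtain ⟨X, rfl⟩ := E.surjective X
    induction X with
    | zero => simp [mkA]
    | tmul b g =>
      have := hgen g (Y * st.s b)
      rwa [← mkA_s_mul, hs, mul_one] at this
    | add x y hx hy => simpa [mkA, add_tmul] using add_mem hx hy
  intro z
  obtain ⟨z, rfl⟩ := Submodule.Quotient.mk_surjective _ z
  change _ ∈ LinearMap.range (st.smashTA E)
  induction z with
  | zero => exact zero_mem _
  | tmul X Y => exact hpure X Y
  | add x y hx hy => exact add_mem hx hy

theorem t_mul_apply {ρ : B →ₗ[k] B ⊗[k] H} (ht : ∀ b, st.t b = E (ρ b))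
    (hmul : ∀ (a : B) (h g : H), E (a ⊗ₜ h) * E (1 ⊗ₜ g) = E (a ⊗ₜ (g * h))) (b : B) (g : H) :
    st.t b * E (1 ⊗ₜ g) = E (LinearMap.lTensor B (LinearMap.mulLeft k g) (ρ b)) := by
  rw [ht]
  induction ρ b with
  | zero => simp
  | tmul x y => simp [hmul]
  | add x y hx hy => simp only [map_add, add_mul, hx, hy]

theorem smashTOp_surjective {ρ : B →ₗ[k] B ⊗[k] H} {T : H →ₗ[k] H}
    (hassoc : ∀ n, TensorProduct.assoc k B H H (LinearMap.rTensor H ρ (ρ n)) =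
      LinearMap.lTensor B comul (ρ n))
    (hcounit : ∀ n, LinearMap.lTensor B (counit (R := k) (A := H)) (ρ n) = n ⊗ₜ[k] (1 : k))
    (hT : HopfAlgebra.antipode k ∘ₗ T = LinearMap.id)
    (hT' : T ∘ₗ HopfAlgebra.antipode k = LinearMap.id)
    (ht : ∀ b, st.t b = E (ρ b))
    (hmul : ∀ (a : B) (h g : H), E (a ⊗ₜ h) * E (1 ⊗ₜ g) = E (a ⊗ₜ (g * h))) :
    Function.Surjective (st.smashTOp E) := by
  have hgen : ∀ (X : L) (g : H), st.mkOp X (E (1 ⊗ₜ g)) ∈ LinearMap.range (st.smashTOp E) := by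
    intro X g
    obtain ⟨X, rfl⟩ := E.surjective X
    induction X with
    | zero => simp [mkOp]
    | tmul a h => exact ⟨_, st.smashTOp_tmul E a h g⟩
    | add x y hx hy => simpa [mkOp, add_tmul] using add_mem hx hy
  have hpure : ∀ X Y : L, st.mkOp X Y ∈ LinearMap.range (st.smashTOp E) := by
    intro X Y
    obtain ⟨Y, rfl⟩ := E.surjective Y
    induction Y with
    | zero => simp [mkOp]
    | tmul b g =>
      have key : ∀ u : B ⊗[k] H,
          st.mkOp X (E (LinearMap.lTensor B (LinearMap.mulLeft k g) (LinearMap.lTensor B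
            (LinearMap.mul' k H ∘ₗ TensorProduct.map T LinearMap.id ∘ₗ
              (TensorProduct.comm k H H).toLinearMap)
            (TensorProduct.assoc k B H H (LinearMap.rTensor H ρ u))))) ∈
          LinearMap.range (st.smashTOp E) := by
        intro u
        induction u with
        | zero => simp [mkOp]
        | tmul c x =>
          have := hgen (X * st.t c) (g * T x)
          rw [mkOp_mul_t, t_mul_apply ht hmul] at this
          convert this using 3
          rw [LinearMap.rTensor_tmul]
          induction ρ c with
          | zero => simp
          | tmul d y => simp
          | add x y hx hy => simp only [add_tmul, map_add, hx, hy]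
        | add x y hx hy => simpa [mkOp, tmul_add] using add_mem hx hy
      simpa [comodule_contract hassoc hcounit (mul_map_inv_id_comm hT hT')] using key (ρ b)
    | add x y hx hy => simpa [mkOp, tmul_add] using add_mem hx hy
  intro z
  obtain ⟨z, rfl⟩ := Submodule.Quotient.mk_surjective _ z
  change _ ∈ LinearMap.range (st.smashTOp E)
  induction z with
  | zero => exact zero_mem _
  | tmul X Y => exact hpure X Y
  | add x y hx hy => exact add_mem hx hy

section CanonicalMaps

variable {cop : L →ₗ[k] st.T2} {cou : L →ₗ[k] B}

theorem lam_smashTOp (hL : st.IsLeftBialgebroid cop cou)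
    (hmul : ∀ (a : B) (h g : H), E (a ⊗ₜ h) * E (1 ⊗ₜ g) = E (a ⊗ₜ (g * h)))
    (hcop : ∀ (a : B) (h : H), cop (E (a ⊗ₜ h)) = st.smashT2 E (a ⊗ₜ comul h))
    (z : B ⊗[k] (H ⊗[k] H)) :
    st.lam cop (st.smashTOp E z) =
      st.smashT2 E (LinearMap.lTensor B (rightTwist LinearMap.id) z) := by
  suffices st.lam cop ∘ₗ st.smashTOp E =
      st.smashT2 E ∘ₗ LinearMap.lTensor B (rightTwist LinearMap.id) from LinearMap.congr_fun this z
  ext a h g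
  simp only [AlgebraTensorModule.curry_apply, LinearMap.restrictScalars_self, curry_apply,
    LinearMap.comp_apply, LinearMap.lTensor_tmul, smashTOp_tmul, hL.lam_mkOp, hcop,
    rightTwist_tmul]
  induction comul (R := k) h with
  | zero => simp
  | tmul x y => simp [smashT2_tmul, rmul_mk2, hmul]
  | add x y hx hy => simp only [tmul_add, map_add, LinearMap.add_apply, hx, hy]

theorem mu_smashTA (hL : st.IsLeftBialgebroid cop cou)
    (hmul : ∀ (a : B) (h g : H), E (a ⊗ₜ h) * E (1 ⊗ₜ g) = E (a ⊗ₜ (g * h)))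
    (hcop : ∀ (a : B) (h : H), cop (E (a ⊗ₜ h)) = st.smashT2 E (a ⊗ₜ comul h))
    (z : B ⊗[k] (H ⊗[k] H)) :
    st.mu cop (st.smashTA E z) =
      st.smashT2 E (LinearMap.lTensor B (leftTwist LinearMap.id) z) := by
  suffices st.mu cop ∘ₗ st.smashTA E =
      st.smashT2 E ∘ₗ LinearMap.lTensor B (leftTwist LinearMap.id) from LinearMap.congr_fun this z
  ext a g h
  simp only [AlgebraTensorModule.curry_apply, LinearMap.restrictScalars_self, curry_apply,
    LinearMap.comp_apply, LinearMap.lTensor_tmul, smashTA_tmul, hL.mu_mkA, hcop,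
    leftTwist_tmul]
  induction comul (R := k) h with
  | zero => simp
  | tmul x y => simp [smashT2_tmul, rmul_mk2, hmul]
  | add x y hx hy => simp only [tmul_add, map_add, LinearMap.add_apply, hx, hy]

end CanonicalMaps

end ActionPresentation

end BgdST

section SmashProduct

variable {k : Type u} [Field k] {H : Type v} [Ring H] [HopfAlgebra k H]
  {B : Type v} [Ring B] [Algebra k B]

theorem smashMul_tmul (act : B →ₗ[k] H →ₗ[k] B) (a b : B) (h g : H) :
    smashMul (fun b h => act b h) (a ⊗ₜ[k] h) (b ⊗ₜ[k] g) =
      TensorProduct.map (LinearMap.mulLeft k a ∘ₗ act b) (LinearMap.mulLeft k g)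
        (comul (R := k) h) := by
  have h1 : ∀ (a b : B) (h g : H), tlift k (fun h1 h2 => (a * act b h1) ⊗ₜ[k] (g * h2))
      (comul (R := k) h) =
      TensorProduct.map (LinearMap.mulLeft k a ∘ₗ act b) (LinearMap.mulLeft k g)
        (comul (R := k) h) := fun a b h g => by
    rw [tlift_eq (TensorProduct.map (LinearMap.mulLeft k a ∘ₗ act b) (LinearMap.mulLeft k g))
      fun x y => by simp]
  have h2 : ∀ (a b : B) (h g : H), tlift k (fun b g => tlift k
      (fun h1 h2 => (a * act b h1) ⊗ₜ[k] (g * h2)) (comul (R := k) h)) (b ⊗ₜ[k] g) =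
      TensorProduct.map (LinearMap.mulLeft k a ∘ₗ act b) (LinearMap.mulLeft k g)
        (comul (R := k) h) := fun a b h g => by
    simp only [h1]
    exact tlift_apply_tmul (((TensorProduct.mapBilinear (RingHom.id k) H H B H).compl₁₂
      ((LinearMap.mulLeft k a).compRight k ∘ₗ act) (LinearMap.mul k H)).compr₂
        (LinearMap.applyₗ (comul (R := k) h))) (fun b g => rfl) b g
  unfold smashMul
  simp only [h2]
  exact tlift_apply_tmul ((LinearMap.lcomp k _ (comul (R := k) (A := H))) ∘ₗ
    (TensorProduct.mapBilinear (RingHom.id k) H H B H).flip (LinearMap.mulLeft k g) ∘ₗ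
      LinearMap.lcomp k B (act b) ∘ₗ LinearMap.mul k B) (fun a h => rfl) a h

theorem smashMul_tmul_one_tmul {act : B →ₗ[k] H →ₗ[k] B}
    (hact : ∀ h : H, act 1 h = algebraMap k B (counit (R := k) h)) (a : B) (h g : H) :
    smashMul (fun b h => act b h) (a ⊗ₜ[k] h) (1 ⊗ₜ[k] g) = a ⊗ₜ[k] (g * h) := by
  have h1 : LinearMap.mulLeft k a ∘ₗ act 1 =
      LinearMap.toSpanSingleton k B a ∘ₗ counit (R := k) (A := H) := by
    ext h
    simp [hact, Algebra.algebraMap_eq_smul_one]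
  have h2 := congrArg
    (TensorProduct.map (LinearMap.toSpanSingleton k B a) (LinearMap.mulLeft k g))
    (rTensor_counit_comul (R := k) h)
  rw [smashMul_tmul, h1]
  rw [LinearMap.rTensor, ← LinearMap.comp_apply, ← TensorProduct.map_comp] at h2
  simpa using h2

theorem smashMul_tmul_one {act : B →ₗ[k] H →ₗ[k] B} (hact : ∀ b : B, act b 1 = b)
    (b a : B) (h : H) :
    smashMul (fun b h => act b h) (b ⊗ₜ[k] 1) (a ⊗ₜ[k] h) = (b * a) ⊗ₜ[k] h := by
  simp [smashMul_tmul, Algebra.TensorProduct.one_def, hact]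

theorem coassoc_of_tlift {ρ : B →ₗ[k] B ⊗[k] H} (b : B) (h :
    tlift k (fun b0 b1 => (b0 ⊗ₜ[k] (comul (R := k) b1) : B ⊗[k] (H ⊗[k] H))) (ρ b) =
    tlift k (fun b0 b1 => tlift k (fun c0 c1 => (c0 ⊗ₜ[k] (c1 ⊗ₜ[k] b1) : B ⊗[k] (H ⊗[k] H)))
      (ρ b0)) (ρ b)) :
    TensorProduct.assoc k B H H (LinearMap.rTensor H ρ (ρ b)) =
      LinearMap.lTensor B comul (ρ b) := by
  rw [tlift_eq (LinearMap.lTensor B comul) fun x y => by simp,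
    tlift_eq ((TensorProduct.assoc k B H H).toLinearMap ∘ₗ LinearMap.rTensor H ρ) fun x y => by
      rw [tlift_eq ((TensorProduct.assoc k B H H).toLinearMap ∘ₗ
        (TensorProduct.mk k (B ⊗[k] H) H).flip y) fun c d => by simp]
      simp] at h
  exact h.symm

theorem counit_of_tlift {ρ : B →ₗ[k] B ⊗[k] H} (b : B)
    (h : tlift k (fun b0 b1 => (counit (R := k) b1 : k) • b0) (ρ b) = b) :
    LinearMap.lTensor B (counit (R := k) (A := H)) (ρ b) = b ⊗ₜ[k] (1 : k) := by
  rw [tlift_eq ((TensorProduct.rid k B).toLinearMap ∘ₗ LinearMap.lTensor B counit)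
    fun x y => by simp] at h
  rw [← TensorProduct.rid_symm_apply, LinearEquiv.eq_symm_apply]
  exact h

theorem cop_eq_smashT2 {L : Type*} [Ring L] [Algebra k L] {st : BgdST k B L}
    {E : B ⊗[k] H ≃ₗ[k] L} (a : B) (h : H) :
    tlift k (fun a h => tlift k (fun h1 h2 => st.mk2 (E (a ⊗ₜ[k] h1))
      (E ((1 : B) ⊗ₜ[k] h2))) (comul (R := k) h)) (a ⊗ₜ[k] h) =
    st.smashT2 E (a ⊗ₜ comul h) := by
  rw [tlift_eq (st.smashT2 E ∘ₗ LinearMap.lTensor B comul) fun x y => ?_]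
  · simp
  · rw [tlift_eq (st.smashT2 E ∘ₗ TensorProduct.mk k B (H ⊗[k] H) x) fun c d => ?_]
    · simp
    · simp [BgdST.smashT2_tmul]

end SmashProduct

end ActionBialgebroid

/-- For a braided-commutative right-right `H`-crossed module algebra `B`, the
action bialgebroid `B # H^{op}` is both a left and an anti-left Hopf algebroid, with
`λ⁻¹((a#h) ⊗_B 1) = (a # h₁) ⊗_{B^{op}} (1 # S⁻¹(h₂))` and
`μ⁻¹(1 ⊗_B (a#h)) = (1 # a₁ S(h₁)) ⊗^{B^{op}} (a₀ # h₂)`. -/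
theorem action_bialgebroid_is_left_and_anti_left_Hopf
    {k : Type u} [Field k] {H : Type v} [Ring H] [HopfAlgebra k H]
    {B : Type v} [Ring B] [Algebra k B]
    (hS : Function.Bijective (HopfAlgebra.antipode (R := k) (A := H)))
    (act : B → H → B) (coact : B → B ⊗[k] H)
    (hcross : IsRRCrossed act coact) (hbr : IsBraidedComm act coact)
    {L0 : Type v} [Ring L0] [Algebra k L0] (ψ : L0 ≃ₗ[k] B ⊗[k] H)
    (hψ1 : ψ 1 = 1) (hψm : ∀ x y : L0, ψ (x * y) = smashMul act (ψ x) (ψ y))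
    (st : BgdST k B L0) (cop : L0 →ₗ[k] st.T2) (cou : L0 →ₗ[k] B)
    (hbgd : st.IsLeftBialgebroid cop cou)
    (hsψ : ∀ b : B, st.s b = ψ.symm (b ⊗ₜ[k] (1 : H)))
    (htψ : ∀ b : B, st.t b = ψ.symm (coact b))
    (hcouψ : ∀ z : L0, cou z =
      tlift k (fun a h => (Coalgebra.counit (R := k) h : k) • a) (ψ z))
    (hcopψ : ∀ z : L0, cop z =
      tlift k (fun a h => tlift k (fun h1 h2 => st.mk2 (ψ.symm (a ⊗ₜ[k] h1))
        (ψ.symm ((1 : B) ⊗ₜ[k] h2))) (Coalgebra.comul (R := k) h)) (ψ z)) :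
    st.IsLeftHopf cop ∧ st.IsAntiLeftHopf cop ∧
    (∀ (a : B) (h : H),
      st.lam cop (tlift k (fun h1 h2 => st.mkOp (ψ.symm (a ⊗ₜ[k] h1))
        (ψ.symm ((1 : B) ⊗ₜ[k]
          (Function.invFun (HopfAlgebra.antipode (R := k) (A := H)) h2))))
        (Coalgebra.comul (R := k) h)) = st.mk2 (ψ.symm (a ⊗ₜ[k] h)) 1) ∧
    (∀ (a : B) (h : H),
      st.mu cop (tlift k (fun b0 b1 => tlift k (fun h1 h2 =>
        st.mkA (ψ.symm ((1 : B) ⊗ₜ[k] (b1 * HopfAlgebra.antipode (R := k) h1)))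
          (ψ.symm (b0 ⊗ₜ[k] h2))) (Coalgebra.comul (R := k) h)) (coact a))
        = st.mk2 1 (ψ.symm (a ⊗ₜ[k] h))) := by
  obtain ⟨⟨act', hact'⟩, ⟨ρ, hρ⟩, hact1, -, hactε, -, -, -, hassoc, hcounit, -⟩ := hcross
  obtain rfl : (fun b h => act' b h) = act := funext fun b => funext fun h => hact' b h
  obtain rfl : ⇑ρ = coact := funext hρ
  have hassoc := fun b => coassoc_of_tlift b (hassoc b)
  have hcounit := fun b => counit_of_tlift b (hcounit b)
  have hmul : ∀ (a : B) (h g : H), ψ.symm (a ⊗ₜ[k] h) * ψ.symm (1 ⊗ₜ[k] g) =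
      ψ.symm (a ⊗ₜ[k] (g * h)) := fun a h g => ψ.injective <| by
    simpa [hψm] using smashMul_tmul_one_tmul hactε a h g
  have hs : ∀ (b a : B) (h : H), st.s b * ψ.symm (a ⊗ₜ[k] h) = ψ.symm ((b * a) ⊗ₜ[k] h) :=
    fun b a h => ψ.injective <| by
      simpa [hψm, hsψ] using smashMul_tmul_one hact1 b a h
  have hcop : ∀ (a : B) (h : H), cop (ψ.symm (a ⊗ₜ[k] h)) =
      st.smashT2 ψ.symm (a ⊗ₜ[k] Coalgebra.comul (R := k) h) := fun a h => by
    rw [hcopψ, LinearEquiv.apply_symm_apply, cop_eq_smashT2]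
  have hone : ψ.symm (1 ⊗ₜ[k] 1) = 1 := by
    rw [← Algebra.TensorProduct.one_def, ← hψ1, LinearEquiv.symm_apply_apply]
  let T : H →ₗ[k] H := (LinearEquiv.ofBijective _ hS).symm.toLinearMap
  have hT : HopfAlgebra.antipode k ∘ₗ T = LinearMap.id :=
    LinearMap.ext fun h => (LinearEquiv.ofBijective _ hS).apply_symm_apply h
  have hT' : T ∘ₗ HopfAlgebra.antipode k = LinearMap.id :=
    LinearMap.ext fun h => (LinearEquiv.ofBijective _ hS).symm_apply_apply h
  have hinv : Function.invFun (HopfAlgebra.antipode (R := k) (A := H)) = T := by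
    funext h
    have := Function.leftInverse_invFun hS.1 (T h)
    rwa [← LinearMap.comp_apply, hT, LinearMap.id_apply] at this
  have hright := rightTwist_rightTwist (mul_map_inv_id_comm hT hT')
  have hright' := rightTwist_rightTwist (mul_map_id_inv_comm hT hT')
  have hleft := leftTwist_leftTwist (mul_map_antipode_id (k := k) (H := H))
  have hleft' := leftTwist_leftTwist (mul_map_id_antipode (k := k) (H := H))
  have hj : Function.Bijective (st.smashT2 ψ.symm) :=
    ⟨BgdST.smashT2_injective hs, BgdST.smashT2_surjective hs⟩
  refine ⟨?_, ?_, fun a h => ?_, fun a h => ?_⟩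
  · have hcomp := hj.comp (lTensor_bijective_of_inverse (N := B) hright hright')
    rw [← LinearMap.coe_comp, show st.smashT2 ψ.symm ∘ₗ _ = st.lam cop ∘ₗ st.smashTOp ψ.symm from
      (LinearMap.ext (BgdST.lam_smashTOp hbgd hmul hcop)).symm, LinearMap.coe_comp] at hcomp
    refine (Function.Bijective.of_comp_iff _ ⟨hcomp.1.of_comp, ?_⟩).1 hcomp
    exact BgdST.smashTOp_surjective hassoc hcounit hT hT' htψ hmul
  · have hcomp := hj.comp (lTensor_bijective_of_inverse (N := B) hleft hleft')
    rw [← LinearMap.coe_comp, show st.smashT2 ψ.symm ∘ₗ _ = st.mu cop ∘ₗ st.smashTA ψ.symm from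
      (LinearMap.ext (BgdST.mu_smashTA hbgd hmul hcop)).symm, LinearMap.coe_comp] at hcomp
    exact (Function.Bijective.of_comp_iff _
      ⟨hcomp.1.of_comp, BgdST.smashTA_surjective hs⟩).1 hcomp
  · rw [hinv, tlift_eq (st.smashTOp ψ.symm ∘ₗ TensorProduct.mk k B (H ⊗[k] H) a ∘ₗ
      LinearMap.lTensor H T) fun x y => by simp [BgdST.smashTOp_tmul]]
    have := rightTwist_tmul T h 1
    rw [LinearMap.mulLeft_one, LinearMap.id_comp] at this
    rw [LinearMap.comp_apply, LinearMap.comp_apply, ← this, TensorProduct.mk_apply,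
      BgdST.lam_smashTOp hbgd hmul hcop, LinearMap.lTensor_tmul, hright, BgdST.smashT2_tmul, hone]
  · rw [tlift_eq (st.smashTA ψ.symm ∘ₗ LinearMap.lTensor B
      (leftTwist (HopfAlgebra.antipode k) ∘ₗ (TensorProduct.mk k H H).flip h)) fun b c => ?_]
    · have h1 : LinearMap.lTensor B (leftTwist LinearMap.id) (LinearMap.lTensor B
          (leftTwist (HopfAlgebra.antipode k) ∘ₗ (TensorProduct.mk k H H).flip h) (ρ a)) =
          LinearMap.lTensor B ((TensorProduct.mk k H H).flip h) (ρ a) := by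
        rw [← LinearMap.comp_apply, ← LinearMap.lTensor_comp]
        congr 2
        exact LinearMap.ext fun x => hleft _
      have h2 : ∀ u : B ⊗[k] H, st.smashT2 ψ.symm
          (LinearMap.lTensor B ((TensorProduct.mk k H H).flip h) u) =
          st.mk2 (ψ.symm u) (ψ.symm (1 ⊗ₜ[k] h)) := fun u => by
        induction u with
        | zero => simp [BgdST.mk2]
        | tmul b g => simp [BgdST.smashT2_tmul]
        | add x y hx hy => simp [hx, hy, BgdST.mk2, add_tmul]
      rw [LinearMap.comp_apply, BgdST.mu_smashTA hbgd hmul hcop, h1, h2, ← htψ]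
      simpa [hs] using st.mk2_t_mul a 1 (ψ.symm (1 ⊗ₜ[k] h))
    · rw [tlift_eq (st.smashTA ψ.symm ∘ₗ TensorProduct.mk k B (H ⊗[k] H) b ∘ₗ
        LinearMap.rTensor H (LinearMap.mulLeft k c ∘ₗ HopfAlgebra.antipode k))
          fun x y => by simp [BgdST.smashTA_tmul]]
      simp [leftTwist_tmul]
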